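/- Let C be the 6×6 real matrix C = (1/4)·[[-3,-1,-1,-1,-1,√3],[-1,1,-3,1,1,-√3],[1,-1,-1,-1,3,√3],[1,3,-1,-1,-1,√3],[1,-1,-1,3,-1,√3],[-√3,√3,√3,√3,√3,1]]. Then the characteristic polynomial of C equals X^6 + X^5 - X^3 + X + 1. -/

import Mathlib

open Matrix Polynomial

/-- The Coxeter automorphism of `E₆` as a linear operator on the 6-dimensional
Euclidean space `𝔼₆`, in the orthonormal basis `e₁, …, e₅, ε₆`. -/
noncomputable def CoxE6 : Matrix (Fin 6) (Fin 6) ℝ :=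
  (1/4 : ℝ) •
    !![-3, -1, -1, -1, -1, Real.sqrt 3;
       -1,  1, -3,  1,  1, -Real.sqrt 3;
        1, -1, -1, -1,  3,  Real.sqrt 3;
        1,  3, -1, -1, -1,  Real.sqrt 3;
        1, -1, -1,  3, -1,  Real.sqrt 3;
       -Real.sqrt 3, Real.sqrt 3, Real.sqrt 3, Real.sqrt 3, Real.sqrt 3, 1]

theorem CoxE6_charpoly :
    CoxE6.charpoly = X ^ 6 + X ^ 5 - X ^ 3 + X + 1 := by
  refine Polynomial.funext fun t => ?_
  have hs : Real.sqrt 3 ^ 2 = 3 := Real.sq_sqrt (by norm_num)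
  have hM : scalar (Fin 6) t - CoxE6 = (1/4 : ℝ) •
      !![4*t+3, 1, 1, 1, 1, -Real.sqrt 3;
         1, 4*t-1, 3, -1, -1, Real.sqrt 3;
         -1, 1, 4*t+1, 1, -3, -Real.sqrt 3;
         -1, -3, 1, 4*t+1, 1, -Real.sqrt 3;
         -1, 1, 1, -3, 4*t+1, -Real.sqrt 3;
         Real.sqrt 3, -Real.sqrt 3, -Real.sqrt 3, -Real.sqrt 3, -Real.sqrt 3, 4*t-1] := by
    ext i j
    fin_cases i <;> fin_cases j <;> simp [CoxE6] <;> ring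
  rw [Matrix.eval_charpoly, hM, det_smul]
  generalize Real.sqrt 3 = s at hs ⊢
  simp [det_succ_row_zero, Fin.sum_univ_succ, Fin.succAbove]
  ring_nf
  simp only [hs]
  ring
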